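/- arXiv:1106.0741 — 2 statements merged into one kernel-verified Lean document; each statement's English description precedes it below -/
import Mathlib

section
/- Let k be a field and m, n ≥ 1; work in the polynomial ring k[z_{ij}, x_{ij} : 1 ≤ i ≤ m, 1 ≤ j ≤ n]. Enumerate the index pairs in row-major order via N(i,j) = (i−1)n + j ∈ {1, …, mn}, and let h_g be the ideal generated by all products z_{ij} x_{lk} with N(i,j) < N(l,k) (i.e. i < l, or i = l and j < k). Then the Alexander dual (h_g)* equals the ideal generated by the monomials (∏_{(i,j): N(i,j) ≤ u} z_{ij}) · (∏_{(l,k): N(l,k) ≥ u+2} x_{lk}) for 0 ≤ u ≤ mn − 1 (empty products equal 1). -/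
open MvPolynomial Finset

/-- The row-major enumeration `N(i,j) = (i−1)n + j` of the entries of an `m × n` matrix,
written in terms of the 0-based coordinates of `Fin m × Fin n`. -/
def rowMajor {m n : ℕ} (p : Fin m × Fin n) : ℕ := (p.1 : ℕ) * n + (p.2 : ℕ) + 1

theorem rowMajor_le_mul {m n : ℕ} (p : Fin m × Fin n) : rowMajor p ≤ m * n := by
  have h : ((p.1 : ℕ) + 1) * n ≤ m * n := Nat.mul_le_mul_right n p.1.isLt
  have h2 := p.2.isLt
  rw [Nat.add_mul] at h
  unfold rowMajor
  omega

theorem prod_X_dvd_monomial {σ R : Type*} [CommSemiring R] {s : Finset σ} {d : σ →₀ ℕ}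
    (h : s ⊆ d.support) (c : R) : ∏ i ∈ s, (X i : MvPolynomial σ R) ∣ monomial d c := by
  rw [monomial_eq]
  refine Dvd.dvd.mul_left ?_ _
  refine (Finset.prod_dvd_prod_of_dvd _ _ fun i hi => ?_).trans
    (Finset.prod_dvd_prod_of_subset _ _ _ h)
  exact dvd_pow_self _ (Finsupp.mem_support_iff.mp (h hi))

theorem mem_span_X_pair {σ R : Type*} [CommSemiring R] {i j : σ} {f : MvPolynomial σ R} :
    f ∈ Ideal.span {X i, X j} ↔ ∀ d ∈ f.support, d i ≠ 0 ∨ d j ≠ 0 := by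
  simpa [Set.image_pair] using mem_ideal_span_X_image (x := f) (s := {i, j})

/-- If every pair `p, q` with `N p < N q` has `p ∈ A` or `q ∈ B`, then some threshold `u`
separates an initial segment contained in `A` from a final segment contained in `B`. -/
theorem exists_threshold_of_rowMajor_cover {m n : ℕ} (A B : Set (Fin m × Fin n))
    (h : ∀ p q : Fin m × Fin n, rowMajor p < rowMajor q → p ∈ A ∨ q ∈ B) :
    ∃ u ≤ m * n - 1, (∀ p : Fin m × Fin n, rowMajor p ≤ u → p ∈ A) ∧
      ∀ q : Fin m × Fin n, u + 2 ≤ rowMajor q → q ∈ B := by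
  classical
  by_cases hA : ∀ p, p ∈ A
  · refine ⟨m * n - 1, le_rfl, fun p _ => hA p, fun q hq => ?_⟩
    have := rowMajor_le_mul q
    omega
  · push Not at hA
    obtain ⟨a, ha⟩ := hA
    obtain ⟨p, hp, hmin⟩ := (univ.filter (· ∉ A)).exists_min_image rowMajor ⟨a, by simpa using ha⟩
    simp only [mem_filter, mem_univ, true_and] at hp hmin
    have hpos : 1 ≤ rowMajor p := Nat.le_add_left _ _
    have hle := rowMajor_le_mul p
    refine ⟨rowMajor p - 1, by omega, fun q hq => ?_, fun q hq => ?_⟩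
    · by_contra hqA
      have := hmin q hqA
      omega
    · exact (h p q (by omega)).resolve_left hp

/-- In `k[z_{ij}, x_{ij}]`, the Alexander dual of the ideal `h_g` generated by the products
`z_{ij}x_{lk}` with `N(i,j) < N(l,k)` is generated by the monomials
`(∏_{N(i,j) ≤ u} z_{ij})·(∏_{N(l,k) ≥ u+2} x_{lk})` for `0 ≤ u ≤ mn − 1`. -/
theorem alexanderDual_hg (k : Type*) [Field k] (m n : ℕ) (hm : 1 ≤ m) (hn : 1 ≤ n) :
    (⨅ (p : Fin m × Fin n) (q : Fin m × Fin n) (_ : rowMajor p < rowMajor q),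
      Ideal.span {(X (Sum.inl p) : MvPolynomial ((Fin m × Fin n) ⊕ (Fin m × Fin n)) k),
        X (Sum.inr q)}) =
    Ideal.span {g : MvPolynomial ((Fin m × Fin n) ⊕ (Fin m × Fin n)) k | ∃ u : ℕ,
      u ≤ m * n - 1 ∧
      g = (∏ p ∈ Finset.univ.filter (fun p : Fin m × Fin n => rowMajor p ≤ u),
            X (Sum.inl p)) *
          ∏ p ∈ Finset.univ.filter (fun p : Fin m × Fin n => u + 2 ≤ rowMajor p),
            X (Sum.inr p)} := by
  apply le_antisymm
  · intro f hf
    simp only [Ideal.mem_iInf, mem_span_X_pair] at hf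
    rw [f.as_sum]
    refine Ideal.sum_mem _ fun d hd => ?_
    obtain ⟨u, hu, hz, hx⟩ := exists_threshold_of_rowMajor_cover
      {p | d (Sum.inl p) ≠ 0} {q | d (Sum.inr q) ≠ 0} fun p q hpq => hf p q hpq d hd
    refine Ideal.mem_of_dvd _ ?_ (Ideal.subset_span ⟨u, hu, rfl⟩)
    rw [← Finset.prod_disjSum _ _ X]
    refine prod_X_dvd_monomial (fun i hi => ?_) _
    rw [Finsupp.mem_support_iff]
    rcases i with p | q
    · exact hz p (by simpa using hi)
    · exact hx q (by simpa using hi)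
  · rw [Ideal.span_le]
    rintro _ ⟨u, -, rfl⟩
    simp only [SetLike.mem_coe, Ideal.mem_iInf]
    intro p q hpq
    by_cases hp : rowMajor p ≤ u
    · refine Ideal.mul_mem_right _ _ (Ideal.mem_of_dvd _ ?_
        (Ideal.subset_span (Set.mem_insert _ _)))
      exact Finset.dvd_prod_of_mem (fun p => X (Sum.inl p)) (by simpa using hp)
    · refine Ideal.mul_mem_left _ _ (Ideal.mem_of_dvd _ ?_
        (Ideal.subset_span (Set.mem_insert_of_mem _ rfl)))
      refine Finset.dvd_prod_of_mem (fun p => X (Sum.inr p)) ?_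
      simp only [mem_filter, mem_univ, true_and]
      omega
end

section
/- Let k be a field and 2 ≤ s ≤ t integers; work in R = k[x_{ij} : 1 ≤ i ≤ s, 1 ≤ j ≤ t]. Let h_X be the ideal generated by all monomials x_{1a_1}x_{2a_2}⋯x_{s a_s} with t ≥ a_1 > a_2 > ⋯ > a_s ≥ 1. Then the Alexander dual (h_X)* equals the ideal generated by the monomials (∏_{j=A_2+2}^{t} x_{1j})(∏_{j=A_3+2}^{A_2} x_{2j})⋯(∏_{j=A_s+2}^{A_{s−1}} x_{s−1,j})(∏_{j=1}^{A_s} x_{s,j}), taken over all integer sequences 0 ≤ A_s < A_{s−1} < ⋯ < A_2 < t (empty products equal 1). -/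
open MvPolynomial Finset

/-- The index of the entry in row `i`, column `j` (1-based) of an `m × n` matrix of variables. -/
def ent (m n : ℕ) (hm : 0 < m) (hn : 0 < n) (i j : ℕ) : Fin m × Fin n :=
  (⟨(i - 1) % m, Nat.mod_lt _ hm⟩, ⟨(j - 1) % n, Nat.mod_lt _ hn⟩)

theorem ent_injOn (m n : ℕ) (hm : 0 < m) (hn : 0 < n) {i i' j j' : ℕ}
    (hi : i ∈ Set.Icc 1 m) (hi' : i' ∈ Set.Icc 1 m) (hj : j ∈ Set.Icc 1 n)
    (hj' : j' ∈ Set.Icc 1 n) (h : ent m n hm hn i j = ent m n hm hn i' j') :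
    i = i' ∧ j = j' := by
  simp only [Set.mem_Icc] at hi hi' hj hj'
  simp only [ent, Prod.mk.injEq, Fin.mk.injEq] at h
  rw [Nat.mod_eq_of_lt (by omega), Nat.mod_eq_of_lt (by omega), Nat.mod_eq_of_lt (by omega),
    Nat.mod_eq_of_lt (by omega)] at h
  omega

theorem prod_X_dvd_monomial_s11 {R σ ι : Type*} [CommSemiring R] (F : Finset ι) (e : ι → σ)
    (he : Set.InjOn e F) (m : σ →₀ ℕ) (hm : ∀ x ∈ F, m (e x) ≠ 0) (c : R) :
    ∏ x ∈ F, (X (e x) : MvPolynomial σ R) ∣ monomial m c := by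
  classical
  have hprod : ∏ x ∈ F, (X (e x) : MvPolynomial σ R) =
      monomial (∑ x ∈ F, Finsupp.single (e x) 1) 1 := by
    rw [monomial_sum_one]
    rfl
  have hle : ∑ x ∈ F, Finsupp.single (e x) 1 ≤ m := by
    intro p
    simp only [Finsupp.finsetSum_apply, Finsupp.single_apply, Finset.sum_boole, Nat.cast_id]
    by_cases hp : ∃ x ∈ F, e x = p
    · obtain ⟨x, hx, rfl⟩ := hp
      refine le_trans (Finset.card_le_one.2 fun a ha b hb => ?_)
        (Nat.one_le_iff_ne_zero.2 (hm x hx))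
      rw [Finset.mem_filter] at ha hb
      exact he ha.1 hb.1 (ha.2.trans hb.2.symm)
    · push Not at hp
      rw [Finset.filter_eq_empty_iff.2 fun x hx => hp x hx]
      simp
  refine ⟨monomial (m - ∑ x ∈ F, Finsupp.single (e x) 1) c, ?_⟩
  rw [hprod, monomial_mul, one_mul, add_tsub_cancel_of_le hle]

/-- A decreasing sequence `a` meets one of the intervals cut out by `A`, with the convention
`A 1 = t` and no lower constraint in the last row. -/
theorem exists_mem_interval_of_decreasing {s t : ℕ} (hs : 1 ≤ s) {a : ℕ → ℕ} (A : ℕ → ℕ)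
    (h1 : 1 ≤ a s) (ht : a 1 ≤ t) (ha : ∀ i, 1 ≤ i → i < s → a (i + 1) < a i) :
    ∃ r ∈ Finset.Icc 1 s, a r ∈ Finset.Icc
      (if r = s then 1 else A (r + 1) + 2) (if r = 1 then t else A r) := by
  by_contra! hcon
  have key : ∀ r, 1 ≤ r → r ≤ s → a r ≤ if r = 1 then t else A r := by
    intro r hr
    induction r, hr using Nat.le_induction with
    | base => exact fun _ => by simpa using ht
    | succ r hr ih =>
      intro hrs
      have h := hcon r (Finset.mem_Icc.2 ⟨hr, by omega⟩)
      have hle := ih (by omega)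
      rw [Finset.mem_Icc, if_neg (by omega : r ≠ s)] at h
      have hlt := ha r hr (by omega)
      rw [if_neg (by omega)]
      by_contra hgt
      exact h ⟨by omega, hle⟩
  exact hcon s (Finset.mem_Icc.2 ⟨hs, le_rfl⟩)
    (Finset.mem_Icc.2 ⟨by simpa using h1, key s hs le_rfl⟩)

/-- Greedy construction of a minimal cover: if every decreasing sequence meets `P`, then `P`
contains all the intervals cut out by some decreasing sequence `A`. -/
theorem exists_intervals_of_forall_decreasing {s t : ℕ} (hs : 2 ≤ s) (hst : s ≤ t)
    (P : ℕ → ℕ → Prop)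
    (hP : ∀ a : ℕ → ℕ, 1 ≤ a s → a 1 ≤ t → (∀ i, 1 ≤ i → i < s → a (i + 1) < a i) →
      ∃ r ∈ Set.Icc 1 s, P r (a r)) :
    ∃ A : ℕ → ℕ, (∀ i, 2 ≤ i → i < s → A (i + 1) < A i) ∧ A 2 < t ∧
      ∀ r ∈ Finset.Icc 1 s, ∀ j ∈ Finset.Icc
        (if r = s then 1 else A (r + 1) + 2) (if r = 1 then t else A r), P r j := by
  classical
  have hex : ∀ r c : ℕ, ∃ j, c < j ∧ (t < j ∨ ¬ P r j) :=
    fun r c => ⟨c + t + 1, by omega, Or.inl (by omega)⟩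
  let c : ℕ → ℕ := fun n =>
    Nat.rec (motive := fun _ => ℕ) 0 (fun i x => Nat.find (hex (s - i) x)) n
  have hc : ∀ i, c (i + 1) = Nat.find (hex (s - i) (c i)) := fun _ => rfl
  have hspec : ∀ i, c i < c (i + 1) ∧ (t < c (i + 1) ∨ ¬ P (s - i) (c (i + 1))) := by
    intro i
    rw [hc]
    exact Nat.find_spec (hex (s - i) (c i))
  have hmin : ∀ i j, c i < j → j < c (i + 1) → P (s - i) j := by
    intro i j h1 h2
    by_contra hn
    rw [hc] at h2
    exact Nat.find_min _ h2 ⟨h1, Or.inr hn⟩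
  have hmono : StrictMono c := strictMono_nat_of_lt_succ fun i => (hspec i).1
  let b : ℕ → ℕ := fun r => c (s + 1 - r)
  have hb : ∀ r, r ≤ s → b (r + 1) < b r := fun r hr => hmono (by omega)
  have hbP : ∀ r, 1 ≤ r → r ≤ s → ∀ j, b (r + 1) < j → j < b r → P r j := by
    intro r hr hrs j h1 h2
    have h := hmin (s - r) j
    rw [show s - (s - r) = r by omega] at h
    refine h ?_ ?_
    · simpa [b] using h1
    · simpa [b, show s + 1 - r = s - r + 1 by omega] using h2
  have hb1 : t < b 1 := by
    by_contra! hle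
    obtain ⟨r, ⟨hr1, hrs⟩, hr⟩ := hP b (by have := hb s le_rfl; omega) hle
      (fun i _ hi => hb i hi.le)
    have h := (hspec (s - r)).2
    rw [show s - (s - r) = r by omega, show s - r + 1 = s + 1 - r by omega] at h
    have hbr : b r ≤ b 1 := hmono.monotone (by omega)
    rcases h with h | h
    · exact absurd h (by change ¬ t < b r; omega)
    · exact h hr
  refine ⟨fun r => min (b r - 1) (t + 1 - r), ?_, ?_, ?_⟩
  · intro i hi his
    have h1 := hb i his.le
    have h2 := hb (i + 1) his
    change min _ _ < min _ _
    omega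
  · change min _ _ < t
    omega
  · intro r hr j hj
    rw [Finset.mem_Icc] at hr hj
    have hbr := hb r hr.2
    refine hbP r hr.1 hr.2 j ?_ ?_
    · by_cases hrs : r = s
      · subst hrs
        have h0 : b (r + 1) = 0 := by simp [b, c]
        simp only [if_true] at hj
        omega
      · have := hb (r + 1) (by omega)
        by_cases h1 : r = 1
        · subst h1; simp only [if_neg hrs, if_true] at hj; omega
        · simp only [if_neg hrs, if_neg h1] at hj; omega
    · by_cases h1 : r = 1
      · subst h1; simp only [if_true] at hj; omega
      · have := hb r hr.2
        simp only [if_neg h1] at hj; omega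

/-- The Alexander dual of the ideal `h_X ⊆ k[x_{ij} : 1 ≤ i ≤ s, 1 ≤ j ≤ t]` generated by the
monomials `x_{1a₁}⋯x_{sa_s}` with `t ≥ a₁ > a₂ > ⋯ > a_s ≥ 1` is generated by the monomials
`(∏_{j=A₂+2}^{t} x_{1j})(∏_{j=A₃+2}^{A₂} x_{2j})⋯(∏_{j=A_s+2}^{A_{s−1}} x_{s−1,j})
(∏_{j=1}^{A_s} x_{sj})` over all `0 ≤ A_s < A_{s−1} < ⋯ < A₂ < t`. -/
theorem alexanderDual_hX (k : Type*) [Field k] (s t : ℕ) (hs : 2 ≤ s) (hst : s ≤ t) :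
    (⨅ a ∈ {a : ℕ → ℕ | 1 ≤ a s ∧ a 1 ≤ t ∧ ∀ i, 1 ≤ i → i < s → a (i + 1) < a i},
      Ideal.span ((fun r => (X (ent s t (by omega) (by omega) r (a r)) :
        MvPolynomial (Fin s × Fin t) k)) '' Set.Icc 1 s)) =
    Ideal.span {g : MvPolynomial (Fin s × Fin t) k | ∃ A : ℕ → ℕ,
      (∀ i, 2 ≤ i → i < s → A (i + 1) < A i) ∧ A 2 < t ∧
      g = ∏ r ∈ Finset.Icc 1 s, ∏ j ∈ Finset.Icc
            (if r = s then 1 else A (r + 1) + 2) (if r = 1 then t else A r),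
          X (ent s t (by omega) (by omega) r j)} := by
  apply le_antisymm
  · intro p hp
    rw [p.as_sum]
    refine Ideal.sum_mem _ fun m hm => ?_
    obtain ⟨A, hA, hA2, hAP⟩ := exists_intervals_of_forall_decreasing hs hst
      (fun r j => m (ent s t (by omega) (by omega) r j) ≠ 0) (by
        intro a h1 ht ha
        have hpa := Ideal.mem_iInf.1 (Ideal.mem_iInf.1 hp a) ⟨h1, ht, ha⟩
        rw [← Function.comp_def X, Set.image_comp, mem_ideal_span_X_image] at hpa
        simpa using hpa m hm)
    refine Ideal.mem_of_dvd _ ?_ (Ideal.subset_span ⟨A, hA, hA2, rfl⟩)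
    rw [Finset.prod_sigma']
    refine prod_X_dvd_monomial_s11 _ (fun x : (_ : ℕ) × ℕ => ent s t _ _ x.1 x.2) ?_ m ?_ _
    · have hcol : ∀ r ∈ Finset.Icc 1 s, ∀ j ∈ Finset.Icc
          (if r = s then 1 else A (r + 1) + 2) (if r = 1 then t else A r), j ∈ Set.Icc 1 t := by
        intro r hr j hj
        rw [Finset.mem_Icc] at hr hj
        have hle : ∀ i, 2 ≤ i → i ≤ s → A i < t := by
          intro i hi
          induction i, hi using Nat.le_induction with
          | base => exact fun _ => hA2
          | succ i hi ih => exact fun h => (hA i hi h).trans (ih (by omega))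
        constructor
        · split_ifs at hj <;> omega
        · by_cases h1 : r = 1
          · simpa [h1] using hj.2
          · have := hle r (by omega) hr.2
            simp only [if_neg h1] at hj
            omega
      rintro ⟨r, j⟩ hx ⟨r', j'⟩ hx' h
      rw [Finset.mem_coe, Finset.mem_sigma] at hx hx'
      obtain ⟨rfl, rfl⟩ := ent_injOn s t _ _ (Finset.mem_Icc.1 hx.1) (Finset.mem_Icc.1 hx'.1)
        (hcol _ hx.1 _ hx.2) (hcol _ hx'.1 _ hx'.2) h
      rfl
    · rintro ⟨r, j⟩ hx
      rw [Finset.mem_sigma] at hx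
      exact hAP r hx.1 j hx.2
  · rw [Ideal.span_le]
    rintro _ ⟨A, -, -, rfl⟩
    refine Ideal.mem_iInf.2 fun a => Ideal.mem_iInf.2 fun ⟨h1, ht, ha⟩ => ?_
    obtain ⟨r, hr, hj⟩ := exists_mem_interval_of_decreasing (by omega) A h1 ht ha
    exact Ideal.mem_of_dvd _
      ((Finset.dvd_prod_of_mem _ hj).trans (Finset.dvd_prod_of_mem _ hr))
      (Ideal.subset_span ⟨r, Finset.mem_Icc.1 hr, rfl⟩)
end
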